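/- Assume σ > 0. Let A₁, A₂ ⊆ 𝓜, set Â₂ := ⋃_{Γ∈A₂} 𝓜_Γ, and let F be a non-negative integrable random variable that is measurable with respect to σ((B_Γ)_{Γ∈A₂}) and independent of the family (B_Γ)_{Γ∈𝓜∖Â₂}. Then for all t ≥ 0: 𝔼[ F · e^{(t/σ)·∑_{Γ∈𝓜∖A₁} B_Γ^c} ] ≤ 𝔼[F] · e^{(t/σ)·|A₁ ∪ Â₂|} · 𝔼[e^{tW}]. In particular, 𝔼[ e^{(t/σ)·∑_{Γ∈𝓜∖A₁} B_Γ^c} ] ≤ e^{(t/σ)·|A₁|} · 𝔼[e^{tW}]. -/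

import Mathlib

open MeasureTheory ProbabilityTheory
open scoped Classical

/-- `Γ ⊆ E(K_n)` is a copy of `G₀` if it is the image of the edge set of `G₀` under an
injection of the vertices. -/
noncomputable def copyFinset {V₀ : Type*} [Fintype V₀] [DecidableEq V₀]
    (G₀ : SimpleGraph V₀) [DecidableRel G₀.Adj] (n : ℕ) :
    Finset (Finset (Sym2 (Fin n))) :=
  Finset.univ.filter (fun Γ => ∃ f : V₀ ↪ Fin n, Γ = G₀.edgeFinset.image (Sym2.map ⇑f))

/-- The product `B_Γ = ∏_{k∈Γ} B_k` of edge indicators. -/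
noncomputable def prodB {Ω : Type*} {n : ℕ} (B : Sym2 (Fin n) → Ω → ℝ)
    (Γ : Finset (Sym2 (Fin n))) (ω : Ω) : ℝ :=
  ∏ k ∈ Γ, B k ω

/-- `σ = √Var(∑_{Γ∈𝓜} B_Γ)`. -/
noncomputable def subgraphSigma {V₀ : Type*} [Fintype V₀] [DecidableEq V₀]
    (G₀ : SimpleGraph V₀) [DecidableRel G₀.Adj] (n : ℕ)
    {Ω : Type*} [MeasurableSpace Ω] (μ : Measure Ω) (B : Sym2 (Fin n) → Ω → ℝ) : ℝ :=
  Real.sqrt ((∫ ω, (∑ Γ ∈ copyFinset G₀ n, prodB B Γ ω) ^ 2 ∂μ) -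
    (∫ ω, ∑ Γ ∈ copyFinset G₀ n, prodB B Γ ω ∂μ) ^ 2)

/-- The standardized subgraph count `W = σ^{−1} ∑_{Γ∈𝓜} B_Γ^c`. -/
noncomputable def subgraphW {V₀ : Type*} [Fintype V₀] [DecidableEq V₀]
    (G₀ : SimpleGraph V₀) [DecidableRel G₀.Adj] (n : ℕ)
    {Ω : Type*} [MeasurableSpace Ω] (μ : Measure Ω) (B : Sym2 (Fin n) → Ω → ℝ)
    (ω : Ω) : ℝ :=
  (subgraphSigma G₀ n μ B)⁻¹ *
    ∑ Γ ∈ copyFinset G₀ n, (prodB B Γ ω - ∫ ω', prodB B Γ ω' ∂μ)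

/-- `Â₂ = ⋃_{Γ∈A₂} 𝓜_Γ`, the set of copies sharing an edge with some element of `A₂`. -/
noncomputable def nbhdOf {V₀ : Type*} [Fintype V₀] [DecidableEq V₀]
    (G₀ : SimpleGraph V₀) [DecidableRel G₀.Adj] (n : ℕ)
    (A₂ : Finset (Finset (Sym2 (Fin n)))) : Finset (Finset (Sym2 (Fin n))) :=
  (copyFinset G₀ n).filter (fun Γ' => ∃ Γ ∈ A₂, (Γ' ∩ Γ).Nonempty)

lemma key_aux {Ω ι : Type*} [DecidableEq ι] [MeasurableSpace Ω] (μ : Measure Ω)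
    [IsProbabilityMeasure μ] (X : ι → Ω → ℝ) (hX : ∀ i, Measurable (X i))
    (h0 : ∀ i ω, 0 ≤ X i ω) (h1 : ∀ i ω, X i ω ≤ 1)
    (M A N : Finset ι) (hA : A ⊆ M) (hN : N ⊆ M)
    (F : Ω → ℝ) (hFpos : ∀ ω, 0 ≤ F ω) (hFint : Integrable F μ)
    (hFi : IndepFun F (fun ω (i : {i // i ∈ M \ N}) => X (i : ι) ω) μ)
    (s : ℝ) (hs : 0 ≤ s) :
    (∫ ω, F ω * Real.exp (s * ∑ i ∈ M \ A, (X i ω - ∫ ω', X i ω' ∂μ)) ∂μ) ≤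
      (∫ ω, F ω ∂μ) * Real.exp (s * ((A ∪ N).card : ℝ)) *
        ∫ ω, Real.exp (s * ∑ i ∈ M, (X i ω - ∫ ω', X i ω' ∂μ)) ∂μ := by
  set m : ι → ℝ := fun i => ∫ ω', X i ω' ∂μ with hm
  have hXint : ∀ i, Integrable (X i) μ := fun i =>
    Integrable.of_bound (hX i).aestronglyMeasurable 1
      (ae_of_all _ fun ω => by rw [Real.norm_eq_abs, abs_of_nonneg (h0 i ω)]; exact h1 i ω)
  have hm0 : ∀ i, 0 ≤ m i := fun i => integral_nonneg (h0 i)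
  have hm1 : ∀ i, m i ≤ 1 := fun i => by
    have := integral_mono (hXint i) (integrable_const (1:ℝ)) (h1 i)
    simpa using this
  have hmeas : ∀ S : Finset ι,
      Measurable fun ω => Real.exp (s * ∑ i ∈ S, (X i ω - m i)) := fun S => by
    have : Measurable fun ω => ∑ i ∈ S, (X i ω - m i) :=
      Finset.measurable_sum _ fun i _ => (hX i).sub_const _
    exact (this.const_mul s).exp
  have hbd : ∀ S : Finset ι, ∀ ω,
      ‖Real.exp (s * ∑ i ∈ S, (X i ω - m i))‖ ≤ Real.exp (s * S.card) := fun S ω => by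
    rw [Real.norm_eq_abs, abs_of_pos (Real.exp_pos _)]
    apply Real.exp_le_exp.2
    apply mul_le_mul_of_nonneg_left _ hs
    calc _ ≤ ∑ i ∈ S, (1:ℝ) := Finset.sum_le_sum fun i _ => by
            linarith [h1 i ω, hm0 i]
      _ = _ := by simp
  have hint : ∀ S : Finset ι,
      Integrable (fun ω => Real.exp (s * ∑ i ∈ S, (X i ω - m i))) μ := fun S =>
    Integrable.of_bound (hmeas S).aestronglyMeasurable _ (ae_of_all _ (hbd S))
  have hintF : ∀ S : Finset ι,
      Integrable (fun ω => F ω * Real.exp (s * ∑ i ∈ S, (X i ω - m i))) μ := fun S =>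
    hFint.mul_bdd (c := Real.exp (s * S.card)) (hmeas S).aestronglyMeasurable (ae_of_all _ (hbd S))
  set U := A ∪ N with hU
  have hUM : U ⊆ M := Finset.union_subset hA hN
  set a : ℝ := ∑ i ∈ U \ A, (1 - m i) with ha
  have hsplit : ∀ f : ι → ℝ, ∑ i ∈ M \ A, f i = ∑ i ∈ M \ U, f i + ∑ i ∈ U \ A, f i := by
    intro f
    rw [← Finset.sum_union]
    · congr 1
      ext i
      have h3 : i ∈ A → i ∈ U := fun h => Finset.mem_union_left _ h
      have h4 := @hUM i
      simp only [Finset.mem_sdiff, Finset.mem_union (s := M \ U)]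
      tauto
    · rw [Finset.disjoint_left]
      intro i hi hi'
      exact (Finset.mem_sdiff.1 hi).2 (Finset.mem_sdiff.1 hi').1
  -- independence
  have hind : IndepFun F (fun ω => Real.exp (s * ∑ i ∈ M \ U, (X i ω - m i))) μ := by
    let g : ({i // i ∈ M \ N} → ℝ) → ℝ := fun y =>
      Real.exp (s * ∑ i ∈ M \ U, ((if h : i ∈ M \ N then y ⟨i, h⟩ else 0) - m i))
    have hg : Measurable g := by
      apply Measurable.exp
      apply Measurable.const_mul
      apply Finset.measurable_sum
      intro i _
      apply Measurable.sub_const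
      by_cases h : i ∈ M \ N
      · simp only [h, dite_true]; exact measurable_pi_apply _
      · simp only [h, dite_false]; exact measurable_const
    have := hFi.comp measurable_id hg
    have e : (fun ω => Real.exp (s * ∑ i ∈ M \ U, (X i ω - m i))) =
        g ∘ (fun ω (i : {i // i ∈ M \ N}) => X (i : ι) ω) := by
      funext ω
      simp only [g, Function.comp]
      congr 2
      apply Finset.sum_congr rfl
      intro i hi
      have : i ∈ M \ N := Finset.sdiff_subset_sdiff (le_refl M) Finset.subset_union_right hi
      rw [dif_pos this]
    rw [e]
    exact this
  have step1 : (∫ ω, F ω * Real.exp (s * ∑ i ∈ M \ A, (X i ω - m i)) ∂μ) ≤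
      ∫ ω, Real.exp (s * a) * (F ω * Real.exp (s * ∑ i ∈ M \ U, (X i ω - m i))) ∂μ := by
    apply integral_mono (hintF _) ((hintF _).const_mul _)
    intro ω
    simp only
    rw [mul_left_comm, ← Real.exp_add, ← mul_add]
    apply mul_le_mul_of_nonneg_left _ (hFpos ω)
    apply Real.exp_le_exp.2
    apply mul_le_mul_of_nonneg_left _ hs
    rw [hsplit]
    have : ∑ i ∈ U \ A, (X i ω - m i) ≤ a :=
      Finset.sum_le_sum fun i _ => by linarith [h1 i ω]
    linarith
  have step2 : (∫ ω, F ω * Real.exp (s * ∑ i ∈ M \ U, (X i ω - m i)) ∂μ) =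
      (∫ ω, F ω ∂μ) * ∫ ω, Real.exp (s * ∑ i ∈ M \ U, (X i ω - m i)) ∂μ :=
    hind.integral_fun_mul_eq_mul_integral hFint.aestronglyMeasurable
      (hmeas _).aestronglyMeasurable
  have step3 : Real.exp (s * a) * ∫ ω, Real.exp (s * ∑ i ∈ M \ U, (X i ω - m i)) ∂μ ≤
      Real.exp (s * (U.card : ℝ)) * ∫ ω, Real.exp (s * ∑ i ∈ M, (X i ω - m i)) ∂μ := by
    rw [← integral_const_mul, ← integral_const_mul]
    apply integral_mono ((hint _).const_mul _) ((hint _).const_mul _)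
    intro ω
    simp only
    rw [← Real.exp_add, ← Real.exp_add, ← mul_add, ← mul_add]
    apply Real.exp_le_exp.2
    apply mul_le_mul_of_nonneg_left _ hs
    rw [← Finset.sum_sdiff hUM]
    have h2 : a ≤ ∑ i ∈ U, (1 - m i) :=
      Finset.sum_le_sum_of_subset_of_nonneg Finset.sdiff_subset
        fun i _ _ => by linarith [hm1 i]
    have h3 : ∑ i ∈ U, (1 - m i) ≤ (U.card : ℝ) + ∑ i ∈ U, (X i ω - m i) := by
      have : (U.card : ℝ) = ∑ i ∈ U, (1 : ℝ) := by simp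
      rw [this, ← Finset.sum_add_distrib]
      exact Finset.sum_le_sum fun i _ => by linarith [h0 i ω]
    linarith
  calc _ ≤ _ := step1
    _ = (∫ ω, F ω ∂μ) *
        (Real.exp (s * a) * ∫ ω, Real.exp (s * ∑ i ∈ M \ U, (X i ω - m i)) ∂μ) := by
      rw [integral_const_mul, step2]; ring
    _ ≤ (∫ ω, F ω ∂μ) *
        (Real.exp (s * (U.card : ℝ)) * ∫ ω, Real.exp (s * ∑ i ∈ M, (X i ω - m i)) ∂μ) :=
      mul_le_mul_of_nonneg_left step3 (integral_nonneg hFpos)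
    _ = _ := by ring

/-- for `A₁, A₂ ⊆ 𝓜`, `Â₂ = ⋃_{Γ∈A₂} 𝓜_Γ`, and `F ≥ 0` a functional of
`(B_Γ)_{Γ∈A₂}` independent of `(B_Γ)_{Γ∈𝓜∖Â₂}`, for all `t ≥ 0`:
`𝔼[F·e^{(t/σ)∑_{Γ∈𝓜∖A₁} B_Γ^c}] ≤ 𝔼[F]·e^{(t/σ)|A₁∪Â₂|}·𝔼[e^{tW}]`; in particular
`𝔼[e^{(t/σ)∑_{Γ∈𝓜∖A₁} B_Γ^c}] ≤ e^{(t/σ)|A₁|}·𝔼[e^{tW}]`. -/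
theorem stmt_17 {V₀ : Type*} [Fintype V₀] [DecidableEq V₀]
    (G₀ : SimpleGraph V₀) [DecidableRel G₀.Adj]
    (hedge : G₀.edgeFinset.Nonempty)
    (hniso : ∀ v : V₀, ∃ w, G₀.Adj v w)
    (n : ℕ) (p : ℝ) (hp : 0 < p) (hp1 : p < 1)
    {Ω : Type*} [MeasurableSpace Ω] (μ : Measure Ω) [IsProbabilityMeasure μ]
    (B : Sym2 (Fin n) → Ω → ℝ) (hBmeas : ∀ k, Measurable (B k))
    (hBval : ∀ k ω, B k ω = 0 ∨ B k ω = 1)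
    (hind : iIndepFun B μ)
    (hmarg : ∀ k, μ {ω | B k ω = 1} = ENNReal.ofReal p)
    (hσ : 0 < subgraphSigma G₀ n μ B)
    (A₁ A₂ : Finset (Finset (Sym2 (Fin n))))
    (hA₁ : A₁ ⊆ copyFinset G₀ n) (hA₂ : A₂ ⊆ copyFinset G₀ n)
    (F : Ω → ℝ) (hFpos : ∀ ω, 0 ≤ F ω) (hFint : Integrable F μ)
    (hFmeas : @Measurable Ω ℝ
      (MeasurableSpace.comap
        (fun ω (Γ : {Γ // Γ ∈ A₂}) => prodB B (Γ : Finset (Sym2 (Fin n))) ω)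
        MeasurableSpace.pi) _ F)
    (hFindep : IndepFun F
      (fun ω (Γ : {Γ // Γ ∈ copyFinset G₀ n \ nbhdOf G₀ n A₂}) =>
        prodB B (Γ : Finset (Sym2 (Fin n))) ω) μ)
    (t : ℝ) (ht : 0 ≤ t) :
    (∫ ω, F ω * Real.exp (t / subgraphSigma G₀ n μ B *
          ∑ Γ ∈ copyFinset G₀ n \ A₁, (prodB B Γ ω - ∫ ω', prodB B Γ ω' ∂μ)) ∂μ) ≤
        (∫ ω, F ω ∂μ) *
          Real.exp (t / subgraphSigma G₀ n μ B * ((A₁ ∪ nbhdOf G₀ n A₂).card : ℝ)) *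
          (∫ ω, Real.exp (t * subgraphW G₀ n μ B ω) ∂μ) ∧
      (∫ ω, Real.exp (t / subgraphSigma G₀ n μ B *
          ∑ Γ ∈ copyFinset G₀ n \ A₁, (prodB B Γ ω - ∫ ω', prodB B Γ ω' ∂μ)) ∂μ) ≤
        Real.exp (t / subgraphSigma G₀ n μ B * (A₁.card : ℝ)) *
          ∫ ω, Real.exp (t * subgraphW G₀ n μ B ω) ∂μ := by
  have hX : ∀ Γ, Measurable (prodB B Γ) := fun Γ =>
    Finset.measurable_prod _ fun k _ => hBmeas k
  have h0 : ∀ Γ ω, 0 ≤ prodB B Γ ω := fun Γ ω =>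
    Finset.prod_nonneg fun k _ => by rcases hBval k ω with h | h <;> simp [h]
  have h1 : ∀ Γ ω, prodB B Γ ω ≤ 1 := fun Γ ω =>
    Finset.prod_le_one (fun k _ => by rcases hBval k ω with h | h <;> simp [h])
      (fun k _ => by rcases hBval k ω with h | h <;> simp [h])
  have hs : 0 ≤ t / subgraphSigma G₀ n μ B := div_nonneg ht hσ.le
  have hW : ∀ ω, t * subgraphW G₀ n μ B ω = t / subgraphSigma G₀ n μ B *
      ∑ Γ ∈ copyFinset G₀ n, (prodB B Γ ω - ∫ ω', prodB B Γ ω' ∂μ) := fun ω => by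
    unfold subgraphW
    rw [div_eq_mul_inv, mul_assoc]
  simp only [hW]
  constructor
  · exact key_aux μ (prodB B) hX h0 h1 (copyFinset G₀ n) A₁ (nbhdOf G₀ n A₂) hA₁
      (Finset.filter_subset _ _) F hFpos hFint hFindep _ hs
  · have := key_aux μ (prodB B) hX h0 h1 (copyFinset G₀ n) A₁ ∅ hA₁
      (Finset.empty_subset _) (fun _ => 1) (fun _ => zero_le_one) (integrable_const _)
      (indepFun_const_left _ _) _ hs
    simpa using this
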